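/- Every De Bruijn sequence of order n over an alphabet of k ≥ 3 symbols can be extended to a De Bruijn sequence of order n+1 over the same alphabet: if s is a string of length k^n + n - 1 over [k] whose windows of length n are pairwise distinct (hence enumerate [k]^n), then there exists a string t of length k^{n+1} + n over [k] whose windows of length n+1 are pairwise distinct (hence enumerate [k]^{n+1}) such that s is a prefix of t. -/

import Mathlib

open Equiv Equiv.Perm in
/-- Composing with a transposition of two points in different cycles merges the cycles. -/
lemma dbx_merge {E : Type*} [Fintype E] [DecidableEq E] (σ : Perm E) (x x' : E)
    (h : ¬ SameCycle σ x x') :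
    (∀ y z, SameCycle σ y z → SameCycle (σ * swap x x') y z) ∧
      SameCycle (σ * swap x x') x x' := by
  set τ := σ * swap x x' with hτ
  have hstep : ∀ y, y ≠ x → y ≠ x' → SameCycle τ y (σ y) := by
    intro y h1 h2
    refine ⟨1, ?_⟩
    simp [hτ, swap_apply_of_ne_of_ne h1 h2]
  have hx : SameCycle τ x (σ x') := ⟨1, by simp [hτ]⟩
  have hx' : SameCycle τ x' (σ x) := ⟨1, by simp [hτ]⟩
  have hind : ∀ j : ℕ, SameCycle τ (σ x') ((σ ^ j) (σ x')) ∨ SameCycle τ (σ x') x' := by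
    intro j
    induction j with
    | zero => left; exact SameCycle.refl _ _
    | succ j ih =>
      rcases ih with ih | ih
      · by_cases h1 : (σ ^ j) (σ x') = x'
        · right; rw [h1] at ih; exact ih
        · left
          have h2 : (σ ^ j) (σ x') ≠ x := by
            intro h2
            apply h
            refine SameCycle.symm ⟨(j + 1 : ℕ), ?_⟩
            rw [zpow_natCast, pow_succ, Perm.mul_apply, h2]
          have := ih.trans (hstep _ h2 h1)
          rw [pow_succ', Perm.mul_apply]
          exact this
      · right; exact ih
  have hc : SameCycle τ (σ x') x' := by
    have hs : SameCycle σ (σ x') x' := SameCycle.symm ⟨1, by simp⟩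
    obtain ⟨j, -, hj⟩ := hs.exists_pow_eq'
    rcases hind j with h1 | h1
    · rwa [hj] at h1
    · exact h1
  have hxx' : SameCycle τ x x' := hx.trans hc
  have hall : ∀ y, SameCycle τ y (σ y) := by
    intro y
    by_cases h1 : y = x
    · subst h1; exact hxx'.trans hx'
    by_cases h2 : y = x'
    · subst h2; exact hc.symm
    exact hstep y h1 h2
  refine ⟨?_, hxx'⟩
  intro y z hyz
  obtain ⟨j, -, hj⟩ := hyz.exists_pow_eq'
  subst hj
  clear hyz
  induction j with
  | zero => exact SameCycle.refl _ _
  | succ j ih =>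
    rw [pow_succ', Perm.mul_apply]
    exact ih.trans (hall _)

open Equiv Equiv.Perm in
/-- A permutation form of Euler's theorem, with a prescribed initial trail. -/
lemma dbx_euler {E V : Type*} [Fintype E] [DecidableEq E] (src tgt : E → V)
    (σ₀ : Perm E) (h₀ : ∀ x, src (σ₀ x) = tgt x) (e : ℕ → E) (m : ℕ)
    (hinj : ∀ i j, i ≤ m → j ≤ m → e i = e j → i = j)
    (hpath : ∀ i, i < m → src (e (i + 1)) = tgt (e i))
    (hconn : ∀ P : V → Prop, P (src (e 0)) →
      (∀ x, (∀ i, i ≤ m → x ≠ e i) → (P (src x) ↔ P (tgt x))) → ∀ v, P v) :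
    ∃ σ : Perm E, (∀ x, src (σ x) = tgt x) ∧ (∀ i, i < m → σ (e i) = e (i + 1)) ∧
      ∀ x, SameCycle σ (e 0) x := by
  classical
  have hex : ∀ j, j ≤ m → ∃ σ : Perm E, (∀ x, src (σ x) = tgt x) ∧
      (∀ i, i < j → σ (e i) = e (i + 1)) := by
    intro j
    induction j with
    | zero => intro _; exact ⟨σ₀, h₀, by simp⟩
    | succ j ih =>
      intro hj
      obtain ⟨σ, h1, h2⟩ := ih (by omega)
      refine ⟨σ * swap (e j) (σ.symm (e (j + 1))), ?_, ?_⟩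
      · have hf : tgt (σ.symm (e (j + 1))) = tgt (e j) := by
          rw [← h1, Equiv.apply_symm_apply, hpath j (by omega)]
        intro x
        rw [Perm.mul_apply, h1, swap_apply_def]
        split_ifs with c1 c2
        · rw [hf, c1]
        · rw [c2, hf]
        · rfl
      · intro i hi
        rcases Nat.lt_succ_iff_lt_or_eq.mp hi with hi | rfl
        · rw [Perm.mul_apply, swap_apply_of_ne_of_ne, h2 i hi]
          · intro h
            have := hinj i j (by omega) (by omega) h
            omega
          · intro h
            have h3 : σ (e i) = e (j + 1) := by rw [h, Equiv.apply_symm_apply]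
            rw [h2 i hi] at h3
            have := hinj _ _ (by omega) (by omega) h3
            omega
        · simp
  let good : Finset (Perm E) := Finset.univ.filter fun σ =>
    (∀ x, src (σ x) = tgt x) ∧ (∀ i, i < m → σ (e i) = e (i + 1))
  have hne : good.Nonempty := by
    obtain ⟨σ, h⟩ := hex m le_rfl
    exact ⟨σ, by simpa [good] using h⟩
  obtain ⟨σ, hσ, hmax⟩ := good.exists_max_image
    (fun σ => (Finset.univ.filter fun x => SameCycle σ (e 0) x).card) hne
  obtain ⟨hv, hc⟩ : (∀ x, src (σ x) = tgt x) ∧ (∀ i, i < m → σ (e i) = e (i + 1)) := by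
    simpa [good] using hσ
  refine ⟨σ, hv, hc, ?_⟩
  -- closure
  have hclos : ∀ x x', tgt x = tgt x' → (∀ i, i < m → x ≠ e i) → (∀ i, i < m → x' ≠ e i) →
      SameCycle σ (e 0) x → SameCycle σ (e 0) x' := by
    intro x x' ht hx hx' hO
    by_contra hO'
    have hn : ¬ SameCycle σ x x' := fun h => hO' (hO.trans h)
    obtain ⟨g1, g2⟩ := dbx_merge σ x x' hn
    have hmem : σ * swap x x' ∈ good := by
      simp only [good, Finset.mem_filter, Finset.mem_univ, true_and]
      refine ⟨?_, ?_⟩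
      · intro y
        rw [Perm.mul_apply, hv, swap_apply_def]
        split_ifs with c1 c2
        · rw [c1, ht]
        · rw [c2, ht]
        · rfl
      · intro i hi
        rw [Perm.mul_apply, swap_apply_of_ne_of_ne (hx i hi).symm (hx' i hi).symm, hc i hi]
    have := hmax _ hmem
    refine absurd this (not_le.mpr (Finset.card_lt_card ?_))
    rw [Finset.ssubset_iff_of_subset]
    · exact ⟨x', by simpa using (g1 _ _ hO).trans g2, by simpa using hO'⟩
    · intro y
      simpa using g1 _ _
  have hpre : ∀ x, (∀ i, i < m → x ≠ e (i + 1)) → ∀ i, i < m → σ.symm x ≠ e i := by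
    intro x hx i hi h
    apply hx i hi
    rw [← hc i hi, ← h, Equiv.apply_symm_apply]
  have hsy : ∀ x, SameCycle σ (σ.symm x) x := fun x => ⟨1, by simp⟩
  have htsy : ∀ x, tgt (σ.symm x) = src x := fun x => by
    rw [← hv, Equiv.apply_symm_apply]
  have hP := hconn (fun v => ∀ x, (∀ i, i < m → x ≠ e i) → tgt x = v → SameCycle σ (e 0) x)
    (by
      intro x hx ht
      refine hclos (σ.symm (e 0)) x (by rw [htsy, ht]) (hpre _ ?_) hx (hsy _).symm
      intro i hi h
      have := hinj _ _ (by omega) (by omega) h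
      omega)
    (by
      intro x hx
      have hx1 : ∀ i, i < m → x ≠ e i := fun i hi => hx i (by omega)
      have hy : ∀ i, i < m → σ.symm x ≠ e i := hpre x fun i hi => hx _ (by omega)
      constructor
      · intro h z hz ht
        have := (h (σ.symm x) hy (htsy x)).trans (hsy x)
        exact hclos x z ht.symm hx1 hz this
      · intro h z hz ht
        have := (h x hx1 rfl).trans (hsy x).symm
        exact hclos _ z (by rw [htsy, ht]) hy hz this)
  intro x
  by_cases hx : ∃ i, i < m ∧ x = e i
  · obtain ⟨i, hi, rfl⟩ := hx
    have : ∀ i, i ≤ m → SameCycle σ (e 0) (e i) := by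
      intro i
      induction i with
      | zero => intro _; exact SameCycle.refl _ _
      | succ i ih =>
        intro hi
        exact (ih (by omega)).trans ⟨1, by simp [hc i (by omega)]⟩
    exact this i (by omega)
  · push Not at hx
    exact hP _ x hx rfl

/-- The word graph stays weakly connected after removing a path with distinct vertices. -/
lemma dbx_conn {k n : ℕ} (hk : 3 ≤ k) (hn : 1 ≤ n) (B : (Fin (n + 1) → Fin k) → Prop)
    (hB1 : ∀ x y, B x → B y → Fin.init x = Fin.init y → x = y)
    (hB2 : ∀ x y, B x → B y → Fin.tail x = Fin.tail y → x = y)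
    (P : (Fin n → Fin k) → Prop)
    (hP : ∀ x : Fin (n + 1) → Fin k, ¬ B x → (P (Fin.init x) ↔ P (Fin.tail x)))
    (v₀ : Fin n → Fin k) (h₀ : P v₀) (v : Fin n → Fin k) : P v := by
  have hne : (0 : Fin (n + 1)) ≠ Fin.last n := by
    intro h
    have := congrArg Fin.val h
    simp at this
    omega
  have hall : ∀ x : Fin (n + 1) → Fin k, P (Fin.init x) ↔ P (Fin.tail x) := by
    intro x
    by_cases hx : B x
    swap
    · exact hP x hx
    have hget : ∀ S : Finset (Fin k), S.card ≤ 2 → ∃ a, a ∉ S := by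
      intro S hS
      by_contra h
      push Not at h
      have : S = Finset.univ := Finset.eq_univ_iff_forall.mpr h
      rw [this, Finset.card_univ, Fintype.card_fin] at hS
      omega
    obtain ⟨b, hb⟩ := hget {x (Fin.last n)} (by simp)
    obtain ⟨a1, ha1⟩ := hget {x 0} (by simp)
    obtain ⟨a2, ha2⟩ := hget {x 0, a1} Finset.card_le_two
    simp only [Finset.mem_singleton, Finset.mem_insert, not_or] at hb ha1 ha2
    set y := Function.update x (Fin.last n) b with hy
    have hyB : ¬ B y := by
      intro h
      have := congrFun (hB1 y x h hx (by rw [hy, Fin.init_update_last])) (Fin.last n)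
      simp [hy] at this
      exact hb this
    have key : ∃ a, a ≠ x 0 ∧ ¬ B (Function.update y 0 a) := by
      by_cases h1 : B (Function.update y 0 a1)
      · refine ⟨a2, ha2.1, fun h2 => ?_⟩
        have := congrFun (hB2 _ _ h1 h2 (by rw [Fin.tail_update_zero, Fin.tail_update_zero])) 0
        simp at this
        exact ha2.2 this.symm
      · exact ⟨a1, ha1, h1⟩
    obtain ⟨a, ha, hza⟩ := key
    have hwB : ¬ B (Function.update x 0 a) := by
      intro h
      have := congrFun (hB2 _ x h hx (by rw [Fin.tail_update_zero])) 0
      simp at this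
      exact ha this
    have e1 := hP y hyB
    have e2 := hP _ hza
    have e3 := hP _ hwB
    rw [Fin.tail_update_zero] at e2 e3
    have hi : Fin.init (Function.update y 0 a) = Fin.init (Function.update x 0 a) := by
      rw [hy, Function.update_comm hne.symm, Fin.init_update_last]
    rw [hi] at e2
    rw [hy, Fin.init_update_last, ← hy] at e1
    rw [e1, ← e2, e3]
  let f : ℕ → Fin k := fun i => if h : i < n then v₀ ⟨i, h⟩ else
    if h' : i - n < n then v ⟨i - n, h'⟩ else ⟨0, by omega⟩
  have hw : ∀ j : ℕ, P (fun i : Fin n => f (i + j)) := by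
    intro j
    induction j with
    | zero => convert h₀ using 2; simp [f]
    | succ j ih =>
      have := (hall (fun i : Fin (n + 1) => f (i + j))).mp ih
      convert this using 2
      simp [Fin.tail]
      congr 1
      omega
  have := hw n
  convert this using 2
  simp [f]

/-- Every De Bruijn sequence of order `n ≥ 1` over an alphabet of `k ≥ 3` symbols can be
extended to a De Bruijn sequence of order `n+1` over the same alphabet: if `s` is a string
of length `k^n + n - 1` over `[k]` whose windows of length `n` are pairwise distinct, then
there is a string `t` of length `k^(n+1) + n` over `[k]` whose windows of length `n+1` are
pairwise distinct and which has `s` as a prefix. -/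
theorem deBruijn_extend_of_three_le (k n : ℕ) (hk : 3 ≤ k) (hn : 1 ≤ n)
    (s : List ℕ) (hslen : s.length = k ^ n + n - 1) (hsk : ∀ σ ∈ s, σ < k)
    (hs : ∀ i j, i + n ≤ s.length → j + n ≤ s.length →
      (s.drop i).take n = (s.drop j).take n → i = j) :
    ∃ t : List ℕ, t.length = k ^ (n + 1) + n ∧ (∀ σ ∈ t, σ < k) ∧
      (∀ i j, i + (n + 1) ≤ t.length → j + (n + 1) ≤ t.length →
        (t.drop i).take (n + 1) = (t.drop j).take (n + 1) → i = j) ∧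
      s <+: t := by
  classical
  have hk0 : 0 < k := by omega
  have hkn : 3 ≤ k ^ n := by
    calc 3 ≤ k := hk
      _ = k ^ 1 := (pow_one k).symm
      _ ≤ k ^ n := Nat.pow_le_pow_right hk0 hn
  obtain ⟨m, hm⟩ : ∃ m, k ^ n = m + 2 := ⟨k ^ n - 2, by omega⟩
  have hlen : s.length = m + n + 1 := by omega
  obtain ⟨f, hf⟩ : ∃ f : ℕ → Fin k, ∀ i, ∀ h : i < s.length, (f i : ℕ) = s[i] :=
    ⟨fun i => if h : i < s.length then ⟨s[i], hsk _ (List.getElem_mem h)⟩ else ⟨0, hk0⟩,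
      fun i h => by simp [h]⟩
  have hwin : ∀ i j, i ≤ m + 1 → j ≤ m + 1 →
      (∀ a, a < n → f (i + a) = f (j + a)) → i = j := by
    intro i j hi hj h
    refine hs i j (by omega) (by omega) ?_
    apply List.ext_getElem
    · simp; omega
    · intro a h1 h2
      simp at h1 h2
      have := congrArg Fin.val (h a (by omega))
      rw [hf _ (by omega), hf _ (by omega)] at this
      simpa using this
  let e : ℕ → (Fin (n + 1) → Fin k) := fun i a => f (i + a)
  have hinit : ∀ i j, i ≤ m → j ≤ m → Fin.init (e i) = Fin.init (e j) → i = j := by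
    intro i j hi hj h
    refine hwin i j (by omega) (by omega) fun a ha => ?_
    simpa [e, Fin.init] using congrFun h ⟨a, ha⟩
  have htail : ∀ i j, i ≤ m → j ≤ m → Fin.tail (e i) = Fin.tail (e j) → i = j := by
    intro i j hi hj h
    have : i + 1 = j + 1 := by
      refine hwin (i + 1) (j + 1) (by omega) (by omega) fun a ha => ?_
      have := congrFun h ⟨a, ha⟩
      simp only [e, Fin.tail, Fin.val_succ] at this
      rw [show i + 1 + a = i + (a + 1) by omega, show j + 1 + a = j + (a + 1) by omega]
      exact this
    omega
  obtain ⟨σ, hv, hc, hcyc⟩ := dbx_euler (E := Fin (n + 1) → Fin k) (V := Fin n → Fin k)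
    Fin.init Fin.tail (Equiv.arrowCongr (finRotate (n + 1)).symm (Equiv.refl _))
    (by
      intro x
      ext a
      simp [Fin.init, Fin.tail, Equiv.arrowCongr])
    e m (fun i j hi hj h => hinit i j hi hj (by rw [h]))
    (by
      intro i hi
      ext a
      simp only [e, Fin.init, Fin.tail, Fin.val_succ, Fin.val_castSucc]
      rw [show i + 1 + (a : ℕ) = i + (a + 1) by omega])
    (by
      intro P h0 hP v
      refine dbx_conn hk hn (fun x => ∃ i, i ≤ m ∧ x = e i) ?_ ?_ P ?_ _ h0 v
      · rintro x y ⟨i, hi, rfl⟩ ⟨j, hj, rfl⟩ h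
        rw [hinit i j hi hj h]
      · rintro x y ⟨i, hi, rfl⟩ ⟨j, hj, rfl⟩ h
        rw [htail i j hi hj h]
      · intro x hx
        push Not at hx
        exact hP x hx)
  have hon : σ.IsCycleOn ((Finset.univ : Finset (Fin (n + 1) → Fin k)) : Set _) := by
    refine ⟨by simp, fun x _ y _ => (hcyc x).symm.trans (hcyc y)⟩
  have hcard : (Finset.univ : Finset (Fin (n + 1) → Fin k)).card = k ^ (n + 1) := by
    simp
  have hinjσ : ∀ i j, i < k ^ (n + 1) → j < k ^ (n + 1) →
      (σ ^ i) (e 0) = (σ ^ j) (e 0) → i = j := by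
    intro i j hi hj h
    rw [hon.pow_apply_eq_pow_apply (Finset.mem_univ _), hcard] at h
    exact Nat.ModEq.eq_of_lt_of_lt h hi hj
  have hpow : ∀ i, i ≤ m → (σ ^ i) (e 0) = e i := by
    intro i
    induction i with
    | zero => intro _; rfl
    | succ i ih =>
      intro hi
      rw [pow_succ', Equiv.Perm.mul_apply, ih (by omega), hc i (by omega)]
  let g : ℕ → Fin k := fun i => (σ ^ i) (e 0) 0
  have hg : ∀ a (ha : a < n + 1) i, (σ ^ i) (e 0) ⟨a, ha⟩ = g (i + a) := by
    intro a
    induction a with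
    | zero => intro ha i; rfl
    | succ a ih =>
      intro ha i
      have h1 := congrFun (hv ((σ ^ i) (e 0))) ⟨a, by omega⟩
      rw [← Equiv.Perm.mul_apply, ← pow_succ'] at h1
      have h2 := ih (by omega) (i + 1)
      rw [show i + (a + 1) = i + 1 + a by omega, ← h2]
      exact h1.symm
  have hgf : ∀ i, i < m + n + 1 → g i = f i := by
    intro i hi
    by_cases him : i ≤ m
    · simp only [g]
      rw [hpow i him]
      simp [e]
    · have h1 := hg (i - m) (by omega) m
      rw [show m + (i - m) = i by omega, hpow m le_rfl] at h1
      rw [← h1]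
      simp only [e]
      rw [show m + (i - m) = i by omega]
  have hbig : m + n + 1 ≤ k ^ (n + 1) + n := by
    have : k ^ n ≤ k ^ (n + 1) := Nat.pow_le_pow_right hk0 (by omega)
    omega
  refine ⟨List.ofFn (fun i : Fin (k ^ (n + 1) + n) => (g i : ℕ)), by simp, ?_, ?_, ?_⟩
  · intro x hx
    rw [List.mem_ofFn] at hx
    obtain ⟨i, rfl⟩ := hx
    exact (g i).isLt
  · intro i j hi hj h
    simp only [List.length_ofFn] at hi hj
    refine hinjσ i j (by omega) (by omega) ?_
    ext a
    rw [hg a a.isLt i, hg a a.isLt j]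
    have h1 := congrArg (fun l => l[(a : ℕ)]?) h
    have ha := a.isLt
    simp only [List.getElem?_take, List.getElem?_drop, if_pos ha] at h1
    rw [List.getElem?_eq_getElem (by simp; omega), List.getElem?_eq_getElem (by simp; omega)] at h1
    simpa using h1
  · rw [List.prefix_iff_eq_take]
    apply List.ext_getElem
    · simp; omega
    · intro i h1 h2
      rw [← hf i h1, ← hgf i (by omega)]
      simp
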